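/- arXiv:1001.4043 — 2 statements merged into one kernel-verified Lean document; each statement's English description precedes it below -/
import Mathlib

section
/- Let ω be the Cantor measure on [0,1], fix 0 < δ < 1/2, choose for each k ≥ 0 and 1 ≤ j ≤ 2^k a point z_j^k ∈ G_j^k whose distance to each endpoint of G_j^k is at least δ·|G_j^k|, and let σ = Σ_{k≥0} Σ_{j=1}^{2^k} (2/9)^k δ_{z_j^k}. Then the dual Pivotal Condition fails for the pair (ω,σ): the open middle thirds {G_r^ℓ : ℓ ≥ 0, 1 ≤ r ≤ 2^ℓ} are pairwise disjoint subintervals of [0,1] and Σ_{ℓ≥0} Σ_{r=1}^{2^ℓ} σ(G_r^ℓ) · P(G_r^ℓ, ω)² = ∞. -/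
open MeasureTheory Set ENNReal

/-- The Poisson integral `P(I,ν)` of the interval `I = [a,b]`. -/
noncomputable def poisson (ν : Measure ℝ) (a b : ℝ) : ℝ≥0∞ :=
  ∫⁻ x, ENNReal.ofReal ((b - a) / ((b - a) + Metric.infDist x (Set.Icc a b)) ^ 2) ∂ν

/-- The left endpoint of the generation-`k` triadic interval of the middle-thirds Cantor
construction determined by the digits `d`. -/
noncomputable def cantorLeft (k : ℕ) (d : Fin k → Bool) : ℝ :=
  ∑ i : Fin k, (cond (d i) 2 0) / 3 ^ ((i : ℕ) + 1)

/-- The generation-`k` closed triadic interval `I_d^k`, of length `3^{-k}`. -/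
noncomputable def cantorI (k : ℕ) (d : Fin k → Bool) : Set ℝ :=
  Set.Icc (cantorLeft k d) (cantorLeft k d + (1/3) ^ k)

/-- The left endpoint of the removed open middle third `G_d^k` of `I_d^k`. -/
noncomputable def gLeft (k : ℕ) (d : Fin k → Bool) : ℝ :=
  cantorLeft k d + (1/3) ^ (k + 1)

/-- The right endpoint of the removed open middle third `G_d^k` of `I_d^k`. -/
noncomputable def gRight (k : ℕ) (d : Fin k → Bool) : ℝ :=
  cantorLeft k d + 2 * (1/3) ^ (k + 1)

/-- `ω` is the Cantor measure on `[0,1]`: the unique Borel probability measure with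
`ω(I_d^k) = 2^{-k}` for every `k ≥ 0` and every generation-`k` triadic interval. -/
def IsCantorMeasure (ω : Measure ℝ) : Prop :=
  IsProbabilityMeasure ω ∧
  ∀ (k : ℕ) (d : Fin k → Bool), ω (cantorI k d) = (1/2 : ℝ≥0∞) ^ k

/-- The points `z_d^k ∈ G_d^k` lie at distance at least `δ·|G_d^k|` from both endpoints of
`G_d^k` (recall `|G_d^k| = 3^{-(k+1)}`). -/
def GoodPoints (δ : ℝ) (z : (k : ℕ) → (Fin k → Bool) → ℝ) : Prop :=
  ∀ (k : ℕ) (d : Fin k → Bool),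
    gLeft k d + δ * (1/3) ^ (k + 1) ≤ z k d ∧ z k d ≤ gRight k d - δ * (1/3) ^ (k + 1)

/-- The measure `σ = Σ_{k,d} (2/9)^k δ_{z_d^k}`. -/
noncomputable def cantorSigma (z : (k : ℕ) → (Fin k → Bool) → ℝ) : Measure ℝ :=
  Measure.sum fun p : Σ k : ℕ, Fin k → Bool =>
    ((2:ℝ≥0∞)/9) ^ p.1 • Measure.dirac (z p.1 p.2)

theorem cantorLeft_succ (k : ℕ) (d : Fin (k + 1) → Bool) :
    cantorLeft (k + 1) d = ((cond (d 0) 2 0 : ℝ) + cantorLeft k (Fin.tail d)) / 3 := by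
  unfold cantorLeft
  rw [Fin.sum_univ_succ, add_div, Finset.sum_div]
  congr 1
  · simp
  · refine Finset.sum_congr rfl fun i _ => ?_
    rw [Fin.tail, Fin.val_succ, div_div, ← pow_succ]

/-- The removed open middle thirds are self-similar under the expanding maps of the Cantor set. -/
theorem mem_Ioo_gLeft_gRight_succ {k : ℕ} {d : Fin (k + 1) → Bool} {x : ℝ}
    (hx : x ∈ Ioo (gLeft (k + 1) d) (gRight (k + 1) d)) :
    3 * x - cond (d 0) 2 0 ∈ Ioo (gLeft k (Fin.tail d)) (gRight k (Fin.tail d)) := by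
  simp only [gLeft, gRight, cantorLeft_succ, mem_Ioo, pow_succ _ (k + 1)] at hx ⊢
  constructor <;> linarith [hx.1, hx.2]

theorem Ioo_gLeft_gRight_zero (d : Fin 0 → Bool) :
    Ioo (gLeft 0 d) (gRight 0 d) = Ioo (1 / 3) (2 / 3) := by
  norm_num [gLeft, gRight, cantorLeft]

theorem Ioo_gLeft_gRight_subset (k : ℕ) (d : Fin k → Bool) :
    Ioo (gLeft k d) (gRight k d) ⊆ Ioo 0 1 := by
  induction k with
  | zero =>
    rw [Ioo_gLeft_gRight_zero]
    exact Ioo_subset_Ioo (by norm_num) (by norm_num)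
  | succ k ih =>
    intro x hx
    have h := ih _ (mem_Ioo_gLeft_gRight_succ hx)
    rw [mem_Ioo] at h ⊢
    cases hd : d 0 <;> simp only [hd, cond_true, cond_false] at h <;>
      constructor <;> linarith [h.1, h.2]

theorem sigma_eq_of_mem_Ioo_gLeft_gRight (k l : ℕ) (d : Fin k → Bool) (e : Fin l → Bool) (x : ℝ)
    (hd : x ∈ Ioo (gLeft k d) (gRight k d)) (he : x ∈ Ioo (gLeft l e) (gRight l e)) :
    (⟨k, d⟩ : Σ k : ℕ, Fin k → Bool) = ⟨l, e⟩ := by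
  have not_zero_succ : ∀ (m : ℕ) (c : Fin 0 → Bool) (f : Fin (m + 1) → Bool) (y : ℝ),
      y ∈ Ioo (gLeft 0 c) (gRight 0 c) →
        y ∉ Ioo (gLeft (m + 1) f) (gRight (m + 1) f) := by
    intro m c f y hc hf
    have h := Ioo_gLeft_gRight_subset _ _ (mem_Ioo_gLeft_gRight_succ hf)
    rw [Ioo_gLeft_gRight_zero, mem_Ioo] at hc
    rw [mem_Ioo] at h
    cases h0 : f 0 <;> simp only [h0, cond_true, cond_false] at h <;>
      linarith [h.1, h.2, hc.1, hc.2]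
  induction k generalizing l x with
  | zero =>
    cases l with
    | zero => rw [Subsingleton.elim d e]
    | succ l => exact (not_zero_succ l d e x hd he).elim
  | succ k ih =>
    cases l with
    | zero => exact (not_zero_succ k e d x he hd).elim
    | succ l =>
      have hd' := mem_Ioo_gLeft_gRight_succ hd
      have he' := mem_Ioo_gLeft_gRight_succ he
      have h0 : d 0 = e 0 := by
        have h1 := Ioo_gLeft_gRight_subset _ _ hd'
        have h2 := Ioo_gLeft_gRight_subset _ _ he'
        rw [mem_Ioo] at h1 h2
        cases hd0 : d 0 <;> cases he0 : e 0 <;>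
          simp only [hd0, he0, cond_true, cond_false] at h1 h2 ⊢ <;>
          linarith [h1.1, h1.2, h2.1, h2.2]
      rw [← h0] at he'
      have h := ih l _ (Fin.tail e) _ hd' he'
      obtain rfl : k = l := congrArg Sigma.fst h
      have ht : Fin.tail d = Fin.tail e := eq_of_heq (Sigma.mk.inj h).2
      rw [← Fin.cons_self_tail d, ← Fin.cons_self_tail e, ht, h0]

theorem gRight_sub_gLeft (k : ℕ) (d : Fin k → Bool) :
    gRight k d - gLeft k d = (1 / 3) ^ (k + 1) := by
  unfold gLeft gRight
  ring

theorem infDist_Icc_gLeft_gRight_le {k : ℕ} {d : Fin k → Bool} {x : ℝ} (hx : x ∈ cantorI k d) :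
    Metric.infDist x (Icc (gLeft k d) (gRight k d)) ≤ (1 / 3) ^ (k + 1) := by
  have hpos : (0 : ℝ) < (1 / 3) ^ (k + 1) := by positivity
  have hlen := gRight_sub_gLeft k d
  have hpow : (1 / 3 : ℝ) ^ k = 3 * (1 / 3) ^ (k + 1) := by ring
  rw [cantorI, mem_Icc, hpow] at hx
  rcases le_total x (gLeft k d) with h | h
  · refine (Metric.infDist_le_dist_of_mem (left_mem_Icc.2 (by linarith))).trans ?_
    rw [Real.dist_eq, abs_of_nonpos (by linarith)]
    unfold gLeft at h ⊢
    linarith [hx.1]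
  rcases le_total x (gRight k d) with h' | h'
  · rw [Metric.infDist_zero_of_mem (mem_Icc.2 ⟨h, h'⟩)]
    exact hpos.le
  · refine (Metric.infDist_le_dist_of_mem (right_mem_Icc.2 (by linarith))).trans ?_
    rw [Real.dist_eq, abs_of_nonneg (by linarith)]
    unfold gRight at h' ⊢
    linarith [hx.2]

theorem IsCantorMeasure.le_poisson {ω : Measure ℝ} (hω : IsCantorMeasure ω) (k : ℕ)
    (d : Fin k → Bool) :
    ENNReal.ofReal (3 / 4 * (3 / 2) ^ k) ≤ poisson ω (gLeft k d) (gRight k d) := by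
  have hmass : ω (cantorI k d) = ENNReal.ofReal ((1 / 2) ^ k) := by
    rw [hω.2, ENNReal.ofReal_pow (by norm_num), ENNReal.ofReal_div_of_pos (by norm_num)]
    norm_num
  calc ENNReal.ofReal (3 / 4 * (3 / 2) ^ k)
      = ENNReal.ofReal (3 ^ (k + 1) / 4) * ω (cantorI k d) := by
        rw [hmass, ← ENNReal.ofReal_mul (by positivity)]
        congr 1
        rw [div_pow, div_pow, one_pow]
        ring
    _ = ∫⁻ _ in cantorI k d, ENNReal.ofReal (3 ^ (k + 1) / 4) ∂ω := by
        rw [setLIntegral_const]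
    _ ≤ ∫⁻ x in cantorI k d, ENNReal.ofReal ((gRight k d - gLeft k d) /
          ((gRight k d - gLeft k d) +
            Metric.infDist x (Icc (gLeft k d) (gRight k d))) ^ 2) ∂ω := by
        refine setLIntegral_mono' measurableSet_Icc fun x hx => ENNReal.ofReal_le_ofReal ?_
        have h := infDist_Icc_gLeft_gRight_le hx
        have h0 : 0 ≤ Metric.infDist x (Icc (gLeft k d) (gRight k d)) := Metric.infDist_nonneg
        rw [gRight_sub_gLeft]
        calc (3 : ℝ) ^ (k + 1) / 4
            = (1 / 3) ^ (k + 1) / ((1 / 3) ^ (k + 1) + (1 / 3) ^ (k + 1)) ^ 2 := by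
              rw [div_pow, one_pow]
              field_simp
              norm_num
          _ ≤ _ := by gcongr
    _ ≤ poisson ω (gLeft k d) (gRight k d) := setLIntegral_le_lintegral _ _

theorem GoodPoints.mem_Ioo {δ : ℝ} (hδ : 0 < δ) {z : (k : ℕ) → (Fin k → Bool) → ℝ}
    (hz : GoodPoints δ z) (k : ℕ) (d : Fin k → Bool) :
    z k d ∈ Ioo (gLeft k d) (gRight k d) := by
  have hpos : 0 < δ * (1 / 3) ^ (k + 1) := by positivity
  constructor <;> linarith [(hz k d).1, (hz k d).2]

theorem le_cantorSigma_of_mem {z : (k : ℕ) → (Fin k → Bool) → ℝ} {s : Set ℝ}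
    {k : ℕ} {d : Fin k → Bool} (h : z k d ∈ s) :
    ENNReal.ofReal ((2 / 9) ^ k) ≤ cantorSigma z s := by
  refine le_trans (le_of_eq ?_) (Measure.le_sum_apply _ s |>.trans' (ENNReal.le_tsum ⟨k, d⟩))
  rw [Measure.smul_apply, Measure.dirac_apply_of_mem h, smul_eq_mul, mul_one,
    ENNReal.ofReal_pow (by norm_num), ENNReal.ofReal_div_of_pos (by norm_num)]
  norm_num

/-- **Failure of the dual Pivotal Condition for the Cantor example.** With `ω` the Cantor
measure, `0 < δ < 1/2`, points `z_d^k ∈ G_d^k` at distance at least `δ|G_d^k|` from the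
endpoints of `G_d^k`, and `σ = Σ_{k,d} (2/9)^k δ_{z_d^k}`: the open middle thirds are
pairwise disjoint subintervals of `[0,1]` and `Σ_{k,d} σ(G_d^k) P(G_d^k, ω)² = ∞`. -/
theorem cantor_dual_pivotal_fails (δ : ℝ) (hδ0 : 0 < δ) (hδ1 : δ < 1/2)
    (ω : Measure ℝ) (hω : IsCantorMeasure ω)
    (z : (k : ℕ) → (Fin k → Bool) → ℝ) (hz : GoodPoints δ z) :
    (∀ p : Σ k : ℕ, Fin k → Bool,
      Set.Ioo (gLeft p.1 p.2) (gRight p.1 p.2) ⊆ Set.Icc 0 1) ∧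
    (Pairwise fun p q : Σ k : ℕ, Fin k → Bool =>
      Disjoint (Set.Ioo (gLeft p.1 p.2) (gRight p.1 p.2))
        (Set.Ioo (gLeft q.1 q.2) (gRight q.1 q.2))) ∧
    ∑' p : Σ k : ℕ, Fin k → Bool,
        cantorSigma z (Set.Ioo (gLeft p.1 p.2) (gRight p.1 p.2)) *
          poisson ω (gLeft p.1 p.2) (gRight p.1 p.2) ^ 2 = ⊤ := by
  refine ⟨fun p => (Ioo_gLeft_gRight_subset p.1 p.2).trans Ioo_subset_Icc_self,
    fun p q hpq => Set.disjoint_left.2 fun x hp hq =>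
      hpq (sigma_eq_of_mem_Ioo_gLeft_gRight p.1 q.1 p.2 q.2 x hp hq), ?_⟩
  rw [ENNReal.tsum_sigma', eq_top_iff,
    ← ENNReal.tsum_const_eq_top_of_ne_zero (α := ℕ) (c := ENNReal.ofReal (9 / 16)) (by simp)]
  refine ENNReal.tsum_le_tsum fun k => ?_
  calc ENNReal.ofReal (9 / 16)
      = ∑' _ : Fin k → Bool,
          ENNReal.ofReal ((2 / 9) ^ k) * ENNReal.ofReal (3 / 4 * (3 / 2) ^ k) ^ 2 := by
        rw [tsum_fintype, Finset.sum_const, Finset.card_univ, Fintype.card_fun, Fintype.card_bool,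
          Fintype.card_fin, ← ENNReal.ofReal_pow (by positivity),
          ← ENNReal.ofReal_mul (by positivity), ← ENNReal.ofReal_nsmul]
        congr 1
        rw [nsmul_eq_mul, mul_pow, ← pow_mul, mul_comm k 2, pow_mul]
        push_cast
        rw [mul_left_comm ((2 / 9 : ℝ) ^ k), mul_left_comm, ← mul_pow, ← mul_pow]
        norm_num
    _ ≤ _ := ENNReal.tsum_le_tsum fun d => by
        gcongr
        · exact le_cantorSigma_of_mem (hz.mem_Ioo hδ0 k d)
        · exact hω.le_poisson k d
end

section
/- Let ω be the Cantor measure on [0,1], fix 0 < δ < 1/2, choose for each k ≥ 0 and 1 ≤ j ≤ 2^k a point z_j^k ∈ G_j^k whose distance to each endpoint of G_j^k is at least δ·|G_j^k|, and let σ = Σ_{k≥0} Σ_{j=1}^{2^k} (2/9)^k δ_{z_j^k}. Then the pair (ω,σ) satisfies the A₂ condition: there is a constant C (depending only on δ) such that P(I,ω)·P(I,σ) ≤ C for every bounded interval I ⊂ ℝ. -/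
open MeasureTheory Set ENNReal

/-- The integer `j` such that `I_d^k = [2j/3^k, (2j+1)/3^k]`. -/
def cantorIndex : (k : ℕ) → (Fin k → Bool) → ℤ
  | 0, _ => 0
  | k + 1, d => 3 * cantorIndex k (Fin.init d) + cond (d (Fin.last k)) 1 0

lemma cantorLeft_eq (k : ℕ) (d : Fin k → Bool) :
    cantorLeft k d = 2 * cantorIndex k d * (1 / 3) ^ k := by
  induction k with
  | zero => simp [cantorLeft, cantorIndex]
  | succ k ih =>
    have h : cantorLeft (k + 1) d =
        cantorLeft k (Fin.init d) + (cond (d (Fin.last k)) 2 0) / 3 ^ (k + 1) := by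
      simp [cantorLeft, Fin.sum_univ_castSucc, Fin.init]
    rw [h, ih, cantorIndex]
    cases d (Fin.last k) <;> simp <;> field_simp <;> ring

lemma cantorIndex_injective (k : ℕ) : Function.Injective (cantorIndex k) := by
  induction k with
  | zero => intro d e _; exact Subsingleton.elim _ _
  | succ k ih =>
    intro d e h
    simp only [cantorIndex] at h
    have h1 : cantorIndex k (Fin.init d) = cantorIndex k (Fin.init e) ∧
        d (Fin.last k) = e (Fin.last k) := by
      cases hd : d (Fin.last k) <;> cases he : e (Fin.last k) <;> simp [hd, he] at h ⊢ <;> omega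
    rw [← Fin.snoc_init_self d, ← Fin.snoc_init_self e, ih h1.1, h1.2]

lemma mem_cantorI_iff {k : ℕ} {d : Fin k → Bool} {x : ℝ} :
    x ∈ cantorI k d ↔
      2 * (cantorIndex k d : ℝ) ≤ 3 ^ k * x ∧ 3 ^ k * x ≤ 2 * cantorIndex k d + 1 := by
  have h3 : (0 : ℝ) < 3 ^ k := by positivity
  have h : (1 / 3 : ℝ) ^ k = 1 / 3 ^ k := by rw [one_div_pow]
  rw [cantorI, Set.mem_Icc, cantorLeft_eq, h, mul_one_div, ← add_div, div_le_iff₀ h3,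
    le_div_iff₀ h3, mul_comm x]

lemma pairwise_disjoint_cantorI (k : ℕ) : Pairwise (Function.onFun Disjoint (cantorI k)) := by
  intro d e hde
  refine Set.disjoint_left.2 fun x hd he => hde (cantorIndex_injective k ?_)
  rw [mem_cantorI_iff] at hd he
  have h1 : 2 * cantorIndex k d ≤ 2 * cantorIndex k e + 1 := by
    exact_mod_cast hd.1.trans he.2
  have h2 : 2 * cantorIndex k e ≤ 2 * cantorIndex k d + 1 := by
    exact_mod_cast he.1.trans hd.2
  omega

lemma measurableSet_cantorI (k : ℕ) (d : Fin k → Bool) : MeasurableSet (cantorI k d) :=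
  measurableSet_Icc

/-- The middle-thirds Cantor set. -/
def middleThirdsSet : Set ℝ := ⋂ k, ⋃ d, cantorI k d

lemma ae_mem_iUnion_cantorI {ω : Measure ℝ} (hω : IsCantorMeasure ω) (k : ℕ) :
    ∀ᵐ x ∂ω, x ∈ ⋃ d, cantorI k d := by
  have := hω.1
  have h : ω (⋃ d, cantorI k d) = 1 := by
    rw [measure_iUnion (pairwise_disjoint_cantorI k) (measurableSet_cantorI k)]
    simp only [hω.2, tsum_fintype, Finset.sum_const, Finset.card_univ, Fintype.card_pi,
      Fintype.card_bool, Finset.prod_const, Fintype.card_fin, nsmul_eq_mul]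
    push_cast
    rw [← mul_pow, one_div, ENNReal.mul_inv_cancel (by simp) (by simp), one_pow]
  exact mem_ae_iff.2
    ((prob_compl_eq_zero_iff (MeasurableSet.iUnion (measurableSet_cantorI k))).2 h)

lemma ae_mem_middleThirdsSet {ω : Measure ℝ} (hω : IsCantorMeasure ω) :
    ∀ᵐ x ∂ω, x ∈ middleThirdsSet := by
  simp only [middleThirdsSet, Set.mem_iInter]
  exact ae_all_iff.2 (ae_mem_iUnion_cantorI hω)

/-- The normalized Poisson-type weight at scale `3^{-k}` centred at `a`. -/
noncomputable def scaleWeight (k : ℕ) (a x : ℝ) : ℝ := 1 / (1 + 3 ^ k * |x - a|) ^ 2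

lemma scaleWeight_nonneg (k : ℕ) (a x : ℝ) : 0 ≤ scaleWeight k a x := by
  unfold scaleWeight; positivity

lemma measurable_scaleWeight (k : ℕ) (a : ℝ) : Measurable (scaleWeight k a) := by
  unfold scaleWeight; fun_prop

lemma summable_inv_one_add_abs_sq : Summable fun m : ℤ => 1 / (1 + |(m : ℝ)|) ^ 2 := by
  have h : Summable fun n : ℕ => 1 / (1 + (n : ℝ)) ^ 2 := by
    have := (summable_nat_add_iff 1).2 (Real.summable_one_div_nat_pow.2 one_lt_two)
    refine this.congr fun n => ?_
    push_cast; rw [add_comm]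
  refine Summable.of_nat_of_neg ?_ ?_ <;> simpa using h

/-- The constant in the uniform bound for sums of weights over one generation. -/
noncomputable def weightConst : ℝ := 25 / 4 * ∑' m : ℤ, 1 / (1 + |(m : ℝ)|) ^ 2

lemma weightConst_nonneg : 0 ≤ weightConst :=
  mul_nonneg (by norm_num) (tsum_nonneg fun _ => by positivity)

lemma scaleWeight_le {k : ℕ} {d : Fin k → Bool} {a x : ℝ} (hx : x ∈ cantorI k d) :
    scaleWeight k a x ≤
      25 / 4 * (1 / (1 + |((cantorIndex k d - ⌊3 ^ k * a / 2⌋ : ℤ) : ℝ)|) ^ 2) := by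
  rw [mem_cantorI_iff] at hx
  have h1 := Int.floor_le (3 ^ k * a / 2)
  have h2 := Int.lt_floor_add_one (3 ^ k * a / 2)
  set m := ⌊3 ^ k * a / 2⌋
  have h3 : (3 : ℝ) ^ k * |x - a| = |3 ^ k * x - 3 ^ k * a| := by
    rw [← mul_sub, abs_mul, abs_of_pos (by positivity : (0 : ℝ) < 3 ^ k)]
  have h4 : 1 + |((cantorIndex k d - m : ℤ) : ℝ)| ≤ 5 / 2 * (1 + 3 ^ k * |x - a|) := by
    rw [h3]
    push_cast
    have h5 := le_abs_self (3 ^ k * x - 3 ^ k * a)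
    have h6 := neg_le_abs (3 ^ k * x - 3 ^ k * a)
    rcases abs_cases ((cantorIndex k d : ℝ) - m) with h | h <;> rw [h.1] <;> linarith
  have h0 : (0 : ℝ) < 1 + |((cantorIndex k d - m : ℤ) : ℝ)| := by positivity
  have h7 := pow_le_pow_left₀ h0.le h4 2
  rw [scaleWeight, mul_one_div, div_le_div_iff₀ (by positivity) (by positivity)]
  nlinarith

lemma lintegral_eq_sum_cantorI {ω : Measure ℝ} (hω : IsCantorMeasure ω) (k : ℕ) (f : ℝ → ℝ≥0∞) :
    ∫⁻ x, f x ∂ω = ∑ d : Fin k → Bool, ∫⁻ x in cantorI k d, f x ∂ω := by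
  rw [← tsum_fintype (L := SummationFilter.unconditional _),
    ← lintegral_iUnion (measurableSet_cantorI k) (pairwise_disjoint_cantorI k),
    Measure.restrict_eq_self_of_ae_mem (ae_mem_iUnion_cantorI hω k)]

lemma cantor_measure_cantorI {ω : Measure ℝ} (hω : IsCantorMeasure ω) (k : ℕ) (d : Fin k → Bool) :
    ω (cantorI k d) = ENNReal.ofReal ((1 / 2) ^ k) := by
  rw [hω.2, ENNReal.ofReal_pow (by norm_num), ENNReal.ofReal_div_of_pos (by norm_num)]
  simp

lemma lintegral_scaleWeight_le {ω : Measure ℝ} (hω : IsCantorMeasure ω) (k : ℕ) (a : ℝ) :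
    ∫⁻ x, ENNReal.ofReal (scaleWeight k a x) ∂ω ≤ ENNReal.ofReal (weightConst * (1 / 2) ^ k) := by
  set m := ⌊3 ^ k * a / 2⌋
  set g : ℤ → ℝ := fun m => 1 / (1 + |(m : ℝ)|) ^ 2 with hg
  have hg0 : ∀ i, 0 ≤ g i := fun i => by positivity
  have hinj : Function.Injective fun d : Fin k → Bool => cantorIndex k d - m :=
    fun d e h => cantorIndex_injective k (sub_left_injective h)
  calc ∫⁻ x, ENNReal.ofReal (scaleWeight k a x) ∂ω
      = ∑ d : Fin k → Bool, ∫⁻ x in cantorI k d, ENNReal.ofReal (scaleWeight k a x) ∂ω :=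
        lintegral_eq_sum_cantorI hω k _
    _ ≤ ∑ d : Fin k → Bool, ENNReal.ofReal (25 / 4 * g (cantorIndex k d - m) * (1 / 2) ^ k) := by
        refine Finset.sum_le_sum fun d _ => ?_
        rw [ENNReal.ofReal_mul (by have := hg0 (cantorIndex k d - m); positivity),
          ← cantor_measure_cantorI hω k d, ← setLIntegral_const]
        exact setLIntegral_mono' (measurableSet_cantorI k d) fun x hx =>
          ENNReal.ofReal_le_ofReal (scaleWeight_le hx)
    _ = ENNReal.ofReal (25 / 4 * (∑ d : Fin k → Bool, g (cantorIndex k d - m)) * (1 / 2) ^ k) := by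
        rw [← ENNReal.ofReal_sum_of_nonneg fun d _ => by
          have := hg0 (cantorIndex k d - m); positivity, ← Finset.sum_mul, ← Finset.mul_sum]
    _ ≤ _ := by
        refine ENNReal.ofReal_le_ofReal ?_
        rw [weightConst]
        gcongr
        rw [← tsum_fintype (L := SummationFilter.unconditional _)]
        exact tsum_comp_le_tsum_of_inj summable_inv_one_add_abs_sq hg0 hinj

lemma sum_scaleWeight_le {ω : Measure ℝ} (hω : IsCantorMeasure ω) {n k : ℕ} (hkn : k ≤ n) (a : ℝ)
    {z : (Fin n → Bool) → ℝ} (hz : ∀ d, z d ∈ cantorI n d) :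
    ∑ d, scaleWeight k a (z d) ≤ 4 * weightConst * (1 / 2) ^ k * 2 ^ n := by
  have key : ∀ d, ∀ x ∈ cantorI n d, scaleWeight k a (z d) ≤ 4 * scaleWeight k a x := by
    intro d x hx
    have h1 : |x - z d| ≤ (1 / 3) ^ n := by
      have h2 := hz d
      rw [cantorI, Set.mem_Icc] at h2 hx
      rw [abs_le]; constructor <;> linarith
    have h2 : (3 : ℝ) ^ k * (1 / 3) ^ n ≤ 1 := by
      rw [one_div_pow, mul_one_div, div_le_one (by positivity)]
      exact pow_le_pow_right₀ (by norm_num) hkn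
    have h3 : 3 ^ k * |x - a| ≤ 3 ^ k * |z d - a| + 1 := by
      have h4 : |x - a| ≤ |x - z d| + |z d - a| := abs_sub_le _ _ _
      have h5 : (0 : ℝ) ≤ 3 ^ k := by positivity
      nlinarith [mul_le_mul_of_nonneg_left h4 h5, mul_le_mul_of_nonneg_left h1 h5]
    have h0 : 0 ≤ 3 ^ k * |z d - a| := by positivity
    have h6 := pow_le_pow_left₀ (by positivity)
      (by linarith : 1 + 3 ^ k * |x - a| ≤ 2 * (1 + 3 ^ k * |z d - a|)) 2
    rw [scaleWeight, scaleWeight, mul_one_div, div_le_div_iff₀ (by positivity) (by positivity)]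
    linarith
  have h : ENNReal.ofReal (∑ d, scaleWeight k a (z d) * (1 / 2) ^ n) ≤
      ENNReal.ofReal (4 * (weightConst * (1 / 2) ^ k)) := by
    calc ENNReal.ofReal (∑ d, scaleWeight k a (z d) * (1 / 2) ^ n)
        = ∑ d, ENNReal.ofReal (scaleWeight k a (z d)) * ω (cantorI n d) := by
          rw [ENNReal.ofReal_sum_of_nonneg fun d _ =>
            mul_nonneg (scaleWeight_nonneg _ _ _) (by positivity)]
          simp_rw [cantor_measure_cantorI hω, ENNReal.ofReal_mul (scaleWeight_nonneg _ _ _)]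
      _ ≤ ∑ d, ∫⁻ x in cantorI n d, ENNReal.ofReal (4 * scaleWeight k a x) ∂ω := by
          refine Finset.sum_le_sum fun d _ => ?_
          rw [← setLIntegral_const]
          exact setLIntegral_mono' (measurableSet_cantorI n d) fun x hx =>
            ENNReal.ofReal_le_ofReal (key d x hx)
      _ = ENNReal.ofReal 4 * ∫⁻ x, ENNReal.ofReal (scaleWeight k a x) ∂ω := by
          rw [← lintegral_eq_sum_cantorI hω n, ← lintegral_const_mul _
            (measurable_scaleWeight k a).ennreal_ofReal]
          simp_rw [ENNReal.ofReal_mul (by norm_num : (0 : ℝ) ≤ 4)]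
      _ ≤ _ := by
          rw [ENNReal.ofReal_mul (by norm_num)]
          gcongr
          exact lintegral_scaleWeight_le hω k a
  rw [ENNReal.ofReal_le_ofReal_iff
    (by have := weightConst_nonneg; positivity), ← Finset.sum_mul, one_div_pow, one_div_pow,
    mul_one_div, div_le_iff₀ (by positivity)] at h
  rw [one_div_pow]
  linarith

lemma GoodPoints.mem_cantorI {δ : ℝ} (hδ0 : 0 < δ) {z : (k : ℕ) → (Fin k → Bool) → ℝ}
    (hz : GoodPoints δ z) (k : ℕ) (d : Fin k → Bool) : z k d ∈ cantorI k d := by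
  obtain ⟨h1, h2⟩ := hz k d
  rw [gLeft] at h1
  rw [gRight] at h2
  have h3 : (0 : ℝ) < (1 / 3) ^ (k + 1) := by positivity
  have h4 : (1 / 3 : ℝ) ^ k = 3 * (1 / 3) ^ (k + 1) := by ring
  have h5 := mul_pos hδ0 h3
  rw [cantorI, Set.mem_Icc, h4]
  constructor <;> linarith

/-- The points `z_d^n` are far from the Cantor set, at the scale of their gap. -/
lemma GoodPoints.le_mul_abs_sub {δ : ℝ} {z : (k : ℕ) → (Fin k → Bool) → ℝ}
    (hz : GoodPoints δ z) (n : ℕ) (d : Fin n → Bool) {x : ℝ} (hx : x ∈ middleThirdsSet) :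
    δ ≤ 3 ^ (n + 1) * |z n d - x| := by
  obtain ⟨h1, h2⟩ := hz n d
  have h3 : (0 : ℝ) < 3 ^ (n + 1) := by positivity
  have h4 : (3 : ℝ) ^ (n + 1) * (1 / 3) ^ (n + 1) = 1 := by rw [← mul_pow]; norm_num
  have h5 : (1 / 3 : ℝ) ^ n = 3 * (1 / 3) ^ (n + 1) := by ring
  rw [gLeft, cantorLeft_eq, h5] at h1
  rw [gRight, cantorLeft_eq, h5] at h2
  have h1' := mul_le_mul_of_nonneg_left h1 h3.le
  have h2' := mul_le_mul_of_nonneg_left h2 h3.le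
  have e1 : (3 : ℝ) ^ (n + 1) * (2 * cantorIndex n d * (3 * (1 / 3) ^ (n + 1)) + (1 / 3) ^ (n + 1)
      + δ * (1 / 3) ^ (n + 1)) = 6 * cantorIndex n d + 1 + δ := by
    linear_combination (6 * (cantorIndex n d : ℝ) + 1 + δ) * h4
  have e2 : (3 : ℝ) ^ (n + 1) * (2 * cantorIndex n d * (3 * (1 / 3) ^ (n + 1))
      + 2 * (1 / 3) ^ (n + 1) - δ * (1 / 3) ^ (n + 1)) = 6 * cantorIndex n d + 2 - δ := by
    linear_combination (6 * (cantorIndex n d : ℝ) + 2 - δ) * h4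
  rw [e1] at h1'
  rw [e2] at h2'
  obtain ⟨e, he⟩ := Set.mem_iUnion.1 (Set.mem_iInter.1 hx (n + 1))
  rw [mem_cantorI_iff] at he
  have h6 : (3 : ℝ) ^ (n + 1) * |z n d - x| = |3 ^ (n + 1) * z n d - 3 ^ (n + 1) * x| := by
    rw [← mul_sub, abs_mul, abs_of_pos h3]
  rw [h6]
  rcases le_or_gt (cantorIndex (n + 1) e) (3 * cantorIndex n d) with h | h
  · have h' : (cantorIndex (n + 1) e : ℝ) ≤ 3 * cantorIndex n d := by exact_mod_cast h
    refine le_trans ?_ (le_abs_self _)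
    linarith
  · have h' : 3 * (cantorIndex n d : ℝ) + 1 ≤ cantorIndex (n + 1) e := by exact_mod_cast h
    refine le_trans ?_ (neg_le_abs _)
    linarith

lemma abs_sub_le_infDist_add {a b : ℝ} (hab : a ≤ b) (x : ℝ) :
    |x - a| ≤ Metric.infDist x (Set.Icc a b) + (b - a) := by
  rw [← sub_le_iff_le_add, Metric.le_infDist (Set.nonempty_Icc.2 hab)]
  intro y hy
  rw [Real.dist_eq]
  have h1 : |x - a| ≤ |x - y| + |y - a| := abs_sub_le _ _ _
  have h2 : |y - a| ≤ b - a := by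
    rw [abs_of_nonneg (by linarith [hy.1])]; linarith [hy.2]
  linarith

lemma poisson_cantor_le {ω : Measure ℝ} (hω : IsCantorMeasure ω) {a b ρ : ℝ} (hab : a < b) {k : ℕ}
    (hk : (1 / 3) ^ (k + 1) ≤ ρ)
    (hρ : ∀ x ∈ middleThirdsSet, ρ ≤ 2 * (b - a + Metric.infDist x (Set.Icc a b))) :
    poisson ω a b ≤ ENNReal.ofReal (81 * weightConst * (b - a) * (9 / 2) ^ k) := by
  have hL : 0 < b - a := sub_pos.2 hab
  calc poisson ω a b
      ≤ ∫⁻ x, ENNReal.ofReal (81 * (b - a) * 9 ^ k * scaleWeight k a x) ∂ω := by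
        refine lintegral_mono_ae ((ae_mem_middleThirdsSet hω).mono fun x hx => ?_)
        refine ENNReal.ofReal_le_ofReal ?_
        have h1 := hρ x hx
        have h2 := abs_sub_le_infDist_add hab.le x
        have h3 : 0 ≤ Metric.infDist x (Set.Icc a b) := Metric.infDist_nonneg
        set t := b - a + Metric.infDist x (Set.Icc a b)
        have ht : 0 < t := by positivity
        have h4 : (3 : ℝ) ^ k * (1 / 3) ^ (k + 1) = 1 / 3 := by
          rw [pow_succ, ← mul_assoc, ← mul_pow]; norm_num
        have h5 : 1 + 3 ^ k * |x - a| ≤ 9 * 3 ^ k * t := by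
          have h6 : (0 : ℝ) ≤ 3 ^ k := by positivity
          have h7 := mul_le_mul_of_nonneg_left (hk.trans h1) h6
          have h8 := mul_le_mul_of_nonneg_left
            (by rw [add_comm] at h2; exact h2 : |x - a| ≤ t) h6
          have h9 : 0 ≤ 3 ^ k * t := by positivity
          linarith
        have h6 := pow_le_pow_left₀ (by positivity) h5 2
        have h7 : ((3 : ℝ) ^ k) ^ 2 = 9 ^ k := by rw [← pow_mul, mul_comm, pow_mul]; norm_num
        rw [scaleWeight, mul_one_div, div_le_div_iff₀ (by positivity) (by positivity)]
        rw [mul_pow, mul_pow, h7] at h6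
        have h8 := mul_le_mul_of_nonneg_left h6 hL.le
        linarith
    _ = ENNReal.ofReal (81 * (b - a) * 9 ^ k) * ∫⁻ x, ENNReal.ofReal (scaleWeight k a x) ∂ω := by
        rw [← lintegral_const_mul _ (measurable_scaleWeight k a).ennreal_ofReal]
        simp_rw [ENNReal.ofReal_mul (by positivity : 0 ≤ 81 * (b - a) * 9 ^ k)]
    _ ≤ ENNReal.ofReal (81 * (b - a) * 9 ^ k) * ENNReal.ofReal (weightConst * (1 / 2) ^ k) := by
        gcongr
        exact lintegral_scaleWeight_le hω k a
    _ = _ := by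
        rw [← ENNReal.ofReal_mul (by positivity)]
        congr 1
        rw [show (9 / 2 : ℝ) = 9 * (1 / 2) by norm_num, mul_pow]
        ring

lemma poisson_cantorSigma (z : (k : ℕ) → (Fin k → Bool) → ℝ) {a b : ℝ} (hab : a ≤ b) :
    poisson (cantorSigma z) a b = ∑' n : ℕ, ENNReal.ofReal ((2 / 9) ^ n * ∑ d : Fin n → Bool,
      (b - a) / ((b - a) + Metric.infDist (z n d) (Set.Icc a b)) ^ 2) := by
  have hL : 0 ≤ b - a := sub_nonneg.2 hab
  have h : ENNReal.ofReal (2 / 9) = 2 / 9 := by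
    rw [ENNReal.ofReal_div_of_pos (by norm_num)]; simp
  rw [poisson, cantorSigma, lintegral_sum_measure, ENNReal.summable.tsum_sigma' fun _ => ENNReal.summable]
  refine tsum_congr fun n => ?_
  rw [tsum_fintype, Finset.mul_sum, ENNReal.ofReal_sum_of_nonneg fun d _ => by positivity]
  refine Finset.sum_congr rfl fun d _ => ?_
  rw [lintegral_smul_measure, lintegral_dirac, ENNReal.ofReal_mul (by positivity),
    ENNReal.ofReal_pow (by positivity), h, smul_eq_mul]

lemma tsum_ofReal_geometric_le {u : ℕ → ℝ} {M : ℝ} (hM : 0 ≤ M) (k : ℕ)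
    (h1 : ∀ n, u (n + k) ≤ M * (4 / 9) ^ n) (h2 : ∀ n < k, u n ≤ M * (2 ^ n / 2 ^ k)) :
    ∑' n, ENNReal.ofReal (u n) ≤ ENNReal.ofReal (3 * M) := by
  rw [← Summable.sum_add_tsum_nat_add' (f := fun n => ENNReal.ofReal (u n)) (k := k)
    ENNReal.summable]
  have ha : ∑ n ∈ Finset.range k, ENNReal.ofReal (u n) ≤ ENNReal.ofReal M := by
    calc ∑ n ∈ Finset.range k, ENNReal.ofReal (u n)
        ≤ ∑ n ∈ Finset.range k, ENNReal.ofReal (M * (2 ^ n / 2 ^ k)) :=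
          Finset.sum_le_sum fun n hn =>
            ENNReal.ofReal_le_ofReal (h2 n (Finset.mem_range.1 hn))
      _ = ENNReal.ofReal (M * ((2 ^ k - 1) / 2 ^ k)) := by
          rw [← ENNReal.ofReal_sum_of_nonneg fun n _ => by positivity, ← Finset.mul_sum,
            ← Finset.sum_div, geom_sum_eq (by norm_num)]
          norm_num
      _ ≤ ENNReal.ofReal M := by
          refine ENNReal.ofReal_le_ofReal (mul_le_of_le_one_right hM ?_)
          rw [div_le_one (by positivity)]
          linarith
  have hb : ∑' n, ENNReal.ofReal (u (n + k)) ≤ ENNReal.ofReal (2 * M) := by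
    have hs := hasSum_geometric_of_lt_one (r := (4 / 9 : ℝ)) (by norm_num) (by norm_num)
    calc ∑' n, ENNReal.ofReal (u (n + k)) ≤ ∑' n : ℕ, ENNReal.ofReal (M * (4 / 9) ^ n) :=
          ENNReal.tsum_le_tsum fun n => ENNReal.ofReal_le_ofReal (h1 n)
      _ = ENNReal.ofReal (M * (1 - 4 / 9)⁻¹) := by
          rw [← ENNReal.ofReal_tsum_of_nonneg (fun n => by positivity)
            (hs.mul_left M).summable, (hs.mul_left M).tsum_eq]
      _ ≤ _ := by
          refine ENNReal.ofReal_le_ofReal ?_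
          norm_num
          linarith
  refine (add_le_add ha hb).trans ?_
  rw [← ENNReal.ofReal_add hM (by positivity)]
  exact ENNReal.ofReal_le_ofReal (by linarith)

lemma poisson_cantorSigma_le_three_div (z : (k : ℕ) → (Fin k → Bool) → ℝ) {a b : ℝ}
    (hab : a < b) : poisson (cantorSigma z) a b ≤ ENNReal.ofReal (3 * (1 / (b - a))) := by
  have hL : 0 < b - a := sub_pos.2 hab
  rw [poisson_cantorSigma z hab.le]
  refine tsum_ofReal_geometric_le (by positivity) 0 (fun n => ?_) (by simp)
  have h : ∀ d : Fin n → Bool,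
      (b - a) / ((b - a) + Metric.infDist (z n d) (Set.Icc a b)) ^ 2 ≤ 1 / (b - a) := by
    intro d
    have h3 : 0 ≤ Metric.infDist (z n d) (Set.Icc a b) := Metric.infDist_nonneg
    rw [div_le_div_iff₀ (by positivity) hL]
    nlinarith
  have h' := Finset.sum_le_sum fun d (_ : d ∈ Finset.univ) => h d
  simp only [Finset.sum_const, Finset.card_univ, Fintype.card_pi,
      Fintype.card_bool, Finset.prod_const, Fintype.card_fin, nsmul_eq_mul] at h'
  push_cast at h'
  rw [add_zero]
  refine (mul_le_mul_of_nonneg_left h' (by positivity)).trans_eq ?_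
  rw [← mul_assoc, ← mul_pow]
  norm_num
  ring

lemma poisson_cantorSigma_le {ω : Measure ℝ} (hω : IsCantorMeasure ω) {δ : ℝ} (hδ0 : 0 < δ)
    {z : (k : ℕ) → (Fin k → Bool) → ℝ} (hz : GoodPoints δ z) {a b ρ x₀ : ℝ} (hab : a < b) {k : ℕ}
    (hk : ρ ≤ (1 / 3) ^ k) (hLρ : b - a ≤ ρ) (hx₀ : x₀ ∈ middleThirdsSet) (hx₀ρ : |x₀ - a| ≤ ρ) :
    poisson (cantorSigma z) a b ≤
      ENNReal.ofReal (3 * (16 * weightConst * (1 + 3 / δ) ^ 2 * (2 / 9) ^ k / (b - a))) := by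
  have hL : 0 < b - a := sub_pos.2 hab
  have hW := weightConst_nonneg
  have h33 : (3 : ℝ) ^ k * (1 / 3) ^ k = 1 := by rw [← mul_pow]; norm_num
  have h3k : (0 : ℝ) < 3 ^ k := by positivity
  have hker : ∀ x : ℝ, (b - a) / ((b - a) + Metric.infDist x (Set.Icc a b)) ^ 2 ≤
      4 / (b - a) * scaleWeight k a x := by
    intro x
    have h2 := abs_sub_le_infDist_add hab.le x
    have h3 : 0 ≤ Metric.infDist x (Set.Icc a b) := Metric.infDist_nonneg
    set t := b - a + Metric.infDist x (Set.Icc a b) with ht_def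
    have ht : 0 < t := by positivity
    have h5 : (b - a) * (1 + 3 ^ k * |x - a|) ≤ 2 * t := by
      have h6 : 3 ^ k * (b - a) ≤ 1 := by
        rw [← h33]; exact mul_le_mul_of_nonneg_left (hLρ.trans hk) h3k.le
      have h7 := mul_le_mul h6 (by linarith : |x - a| ≤ t) (abs_nonneg _) zero_le_one
      linarith
    have h6 := pow_le_pow_left₀ (by positivity) h5 2
    rw [scaleWeight, div_mul_div_comm, mul_one, div_le_div_iff₀ (by positivity) (by positivity)]
    linarith
  have hsum : ∀ n, (2 / 9 : ℝ) ^ n * ∑ d : Fin n → Bool,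
      (b - a) / ((b - a) + Metric.infDist (z n d) (Set.Icc a b)) ^ 2 ≤
      (2 / 9) ^ n * (4 / (b - a) * ∑ d : Fin n → Bool, scaleWeight k a (z n d)) := by
    intro n
    rw [Finset.mul_sum (s := Finset.univ) (a := 4 / (b - a))]
    gcongr
    exact hker _
  have hδ1 : 1 ≤ (1 + 3 / δ) ^ 2 :=
    one_le_pow₀ (le_add_of_nonneg_right (by positivity))
  rw [poisson_cantorSigma z hab.le]
  refine tsum_ofReal_geometric_le (by positivity) k (fun n => (hsum _).trans ?_)
    (fun n hn => (hsum _).trans ?_)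
  · have h := sum_scaleWeight_le hω (Nat.le_add_left k n) a (hz.mem_cantorI hδ0 (n + k))
    calc (2 / 9 : ℝ) ^ (n + k) * (4 / (b - a) * ∑ d, scaleWeight k a (z (n + k) d))
        ≤ (2 / 9) ^ (n + k) * (4 / (b - a) * (4 * weightConst * (1 / 2) ^ k * 2 ^ (n + k))) := by
          gcongr
      _ = 16 * weightConst * 1 * (2 / 9) ^ k / (b - a) * (4 / 9) ^ n := by
          have e1 : (2 / 9 : ℝ) ^ n * 2 ^ n = (4 / 9) ^ n := by rw [← mul_pow]; norm_num
          have e2 : (1 / 2 : ℝ) ^ k * 2 ^ k = 1 := by rw [← mul_pow]; norm_num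
          rw [pow_add, pow_add, ← e1]
          linear_combination (2 / 9) ^ n * (2 / 9) ^ k * (4 / (b - a)) * 4 * weightConst *
            2 ^ n * e2
      _ ≤ _ := by gcongr
  · have hw : ∀ d : Fin n → Bool, scaleWeight k a (z n d) ≤
        (1 + 3 / δ) ^ 2 * (9 ^ n / 9 ^ k) * scaleWeight n a (z n d) := by
      intro d
      have h1 := hz.le_mul_abs_sub n d hx₀
      have h2 : |z n d - x₀| ≤ |z n d - a| + ρ := by
        have h4 : |z n d - x₀| ≤ |z n d - a| + |a - x₀| := abs_sub_le _ _ _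
        rw [abs_sub_comm a] at h4
        linarith
      have h3n : (0 : ℝ) < 3 ^ n := by positivity
      set y := |z n d - a|
      have hy : 0 ≤ y := abs_nonneg _
      have h3 : δ * 3 ^ k ≤ 3 * 3 ^ n * (1 + 3 ^ k * y) := by
        calc δ * 3 ^ k ≤ 3 ^ (n + 1) * (y + (1 / 3) ^ k) * 3 ^ k := by
              gcongr
              exact h1.trans (by gcongr; linarith)
          _ = _ := by
              rw [pow_succ]
              linear_combination 3 * 3 ^ n * h33
      have h4 : 3 ^ k * (1 + 3 ^ n * y) ≤ (1 + 3 / δ) * 3 ^ n * (1 + 3 ^ k * y) := by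
        have h5 : (3 : ℝ) ^ k ≤ 3 / δ * 3 ^ n * (1 + 3 ^ k * y) := by
          rw [div_mul_eq_mul_div, div_mul_eq_mul_div, le_div_iff₀ hδ0]
          linarith
        nlinarith
      have h5 := pow_le_pow_left₀ (by positivity) h4 2
      have e : ∀ m : ℕ, ((3 : ℝ) ^ m) ^ 2 = 9 ^ m := fun m => by
        rw [← pow_mul, mul_comm, pow_mul]; norm_num
      rw [mul_pow, mul_pow, mul_pow, e, e] at h5
      rw [scaleWeight, scaleWeight, mul_one_div, ← mul_div_assoc, div_div,
        div_le_div_iff₀ (by positivity) (by positivity)]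
      linarith
    have h := sum_scaleWeight_le hω le_rfl a (hz.mem_cantorI hδ0 n)
    calc (2 / 9 : ℝ) ^ n * (4 / (b - a) * ∑ d, scaleWeight k a (z n d))
        ≤ (2 / 9) ^ n * (4 / (b - a) * ((1 + 3 / δ) ^ 2 * (9 ^ n / 9 ^ k) *
            (4 * weightConst * (1 / 2) ^ n * 2 ^ n))) := by
          gcongr
          refine (Finset.sum_le_sum fun d _ => hw d).trans ?_
          rw [← Finset.mul_sum]
          gcongr
      _ = _ := by
          have e1 : (2 / 9 : ℝ) ^ n * 9 ^ n = 2 ^ n := by rw [← mul_pow]; norm_num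
          have e2 : (1 / 2 : ℝ) ^ n * 2 ^ n = 1 := by rw [← mul_pow]; norm_num
          have e3 : (2 / 9 : ℝ) ^ k / 2 ^ k = 1 / 9 ^ k := by
            rw [← div_pow, ← one_div_pow]; norm_num
          calc _ = 16 * weightConst * (1 + 3 / δ) ^ 2 / (b - a) * ((2 / 9) ^ n * 9 ^ n)
                * (1 / 9 ^ k) * ((1 / 2) ^ n * 2 ^ n) := by ring
            _ = _ := by rw [e1, e2, ← e3]; ring

/-- **The A₂ condition for the Cantor example.** With `ω` the Cantor measure, `0 < δ < 1/2`,
points `z_d^k ∈ G_d^k` at distance at least `δ|G_d^k|` from the endpoints of `G_d^k`, and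
`σ = Σ_{k,d} (2/9)^k δ_{z_d^k}`, there is `C = C(δ)` such that
`P(I,ω)·P(I,σ) ≤ C` for every bounded interval `I ⊆ ℝ`. -/
theorem cantor_A2_condition (δ : ℝ) (hδ0 : 0 < δ) (hδ1 : δ < 1/2) :
    ∃ C : ℝ, 0 < C ∧
      ∀ ω : Measure ℝ, IsCantorMeasure ω →
      ∀ z : (k : ℕ) → (Fin k → Bool) → ℝ, GoodPoints δ z →
      ∀ a b : ℝ, a ≤ b →
        poisson ω a b * poisson (cantorSigma z) a b ≤ ENNReal.ofReal C := by
  have hW := weightConst_nonneg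
  set K := 16 * weightConst * (1 + 3 / δ) ^ 2 with hK_def
  have hK : 0 ≤ K := by positivity
  refine ⟨243 * weightConst * (K + 1) + 1, by positivity, fun ω hω z hz a b hab => ?_⟩
  rcases hab.eq_or_lt with rfl | hlt
  · simp [poisson]
  have hL : 0 < b - a := sub_pos.2 hlt
  have := hω.1
  obtain ⟨x, hx⟩ := (ae_mem_middleThirdsSet hω).exists
  set S := (fun x => Metric.infDist x (Set.Icc a b)) '' middleThirdsSet with hS
  obtain ⟨_, ⟨x₀, hx₀, rfl⟩, hmin⟩ := Real.lt_sInf_add_pos (s := S) ⟨_, x, hx, rfl⟩ hL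
  have hbdd : BddBelow S := ⟨0, by rintro _ ⟨y, _, rfl⟩; exact Metric.infDist_nonneg⟩
  have hmin' : ∀ y ∈ middleThirdsSet,
      Metric.infDist x₀ (Set.Icc a b) ≤ Metric.infDist y (Set.Icc a b) + (b - a) := fun y hy =>
    hmin.le.trans (by gcongr; exact csInf_le hbdd ⟨y, hy, rfl⟩)
  have hD : 0 ≤ Metric.infDist x₀ (Set.Icc a b) := Metric.infDist_nonneg
  have hx₀ρ := abs_sub_le_infDist_add hab x₀
  set ρ := Metric.infDist x₀ (Set.Icc a b) + (b - a) with hρ_def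
  have hρ : ∀ y ∈ middleThirdsSet, ρ ≤ 2 * (b - a + Metric.infDist y (Set.Icc a b)) := by
    intro y hy
    have h1 := hmin' y hy
    have h2 : 0 ≤ Metric.infDist y (Set.Icc a b) := Metric.infDist_nonneg
    linarith
  have hprod : ∀ (k : ℕ) (M : ℝ), 0 ≤ M → M ≤ K + 1 → (1 / 3) ^ (k + 1) ≤ ρ →
      poisson (cantorSigma z) a b ≤ ENNReal.ofReal (3 * (M * (2 / 9) ^ k / (b - a))) →
      poisson ω a b * poisson (cantorSigma z) a b ≤
        ENNReal.ofReal (243 * weightConst * (K + 1) + 1) := by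
    intro k M hM0 hM hk hσ
    refine (mul_le_mul' (poisson_cantor_le hω hlt hk hρ) hσ).trans ?_
    rw [← ENNReal.ofReal_mul (by positivity)]
    refine ENNReal.ofReal_le_ofReal ?_
    have e : (9 / 2 : ℝ) ^ k * (2 / 9) ^ k = 1 := by rw [← mul_pow]; norm_num
    calc 81 * weightConst * (b - a) * (9 / 2) ^ k * (3 * (M * (2 / 9) ^ k / (b - a)))
        = 243 * weightConst * M * ((9 / 2) ^ k * (2 / 9) ^ k) * ((b - a) / (b - a)) := by ring
      _ = 243 * weightConst * M := by rw [e, div_self hL.ne']; ring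
      _ ≤ 243 * weightConst * (K + 1) := by gcongr
      _ ≤ _ := by linarith
  rcases le_or_gt ρ 1 with h1 | h1
  · obtain ⟨k, hk1, hk2⟩ := exists_nat_pow_near_of_lt_one (by linarith : 0 < ρ) h1
      (by norm_num : (0 : ℝ) < 1 / 3) (by norm_num)
    exact hprod k K hK (by linarith) hk1.le
      (poisson_cantorSigma_le hω hδ0 hz hlt hk2 (by linarith) hx₀ hx₀ρ)
  · exact hprod 0 1 zero_le_one (by linarith) (by norm_num; linarith)
      (by simpa using poisson_cantorSigma_le_three_div z hlt)
end
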